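/- Let (δ_n) be a real sequence, (γ_n) strictly positive, and (σ_n) strictly positive. If ∑_n (σ_n − 1)² < ∞, then the infinite product measures ⊗_{n∈ℕ} μ(δ_n, γ_n) and ⊗_{n∈ℕ} μ(δ_n, σ_n γ_n) on ℝ^ℕ are mutually absolutely continuous. -/

import Mathlib

open MeasureTheory Real

/-- The Cauchy measure on `ℝ` with location parameter `δ` and scale parameter `γ`. -/
noncomputable def cauchyMeasure (δ γ : ℝ) : Measure ℝ :=
  volume.withDensity fun x => ENNReal.ofReal (γ / (π * ((x - δ) ^ 2 + γ ^ 2)))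

open scoped ENNReal

section Product

variable {ι : Type*} [Fintype ι] {X : ι → Type*} [∀ i, MeasurableSpace (X i)]

lemma lintegral_pi_prod_eq_prod_lintegral (ν : ∀ i, Measure (X i)) [∀ i, IsProbabilityMeasure (ν i)]
    {f : ∀ i, X i → ℝ≥0∞} (hf : ∀ i, Measurable (f i)) :
    ∫⁻ x, ∏ i, f i (x i) ∂Measure.pi ν = ∏ i, ∫⁻ x, f i x ∂ν i := by
  have h := ProbabilityTheory.iIndepFun_pi (μ := ν) (X := f) fun i => (hf i).aemeasurable
  rw [ProbabilityTheory.lintegral_prod_eq_prod_lintegral_of_indepFun Finset.univ _ h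
    fun i => (hf i).comp (measurable_pi_apply i)]
  exact Finset.prod_congr rfl fun i _ => (measurePreserving_eval ν i).lintegral_comp (hf i)

lemma pi_withDensity_eq_withDensity_pi (ν : ∀ i, Measure (X i)) [∀ i, IsProbabilityMeasure (ν i)]
    {f : ∀ i, X i → ℝ≥0∞} (hf : ∀ i, Measurable (f i))
    [∀ i, SigmaFinite ((ν i).withDensity (f i))] :
    Measure.pi (fun i => (ν i).withDensity (f i)) =
      (Measure.pi ν).withDensity fun x => ∏ i, f i (x i) := by
  refine Measure.pi_eq fun s hs => ?_
  have hs' : MeasurableSet (Set.univ.pi s) := MeasurableSet.univ_pi hs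
  rw [withDensity_apply _ hs', ← lintegral_indicator hs']
  have h_ind : (Set.univ.pi s).indicator (fun x : ∀ i, X i => ∏ i, f i (x i)) =
      fun x => ∏ i, (s i).indicator (f i) (x i) := by
    classical
    ext x
    simp only [Set.indicator_apply, Finset.prod_ite_zero, Set.mem_univ_pi, Finset.mem_univ,
      forall_true_left]
  rw [h_ind, lintegral_pi_prod_eq_prod_lintegral ν fun i => (hf i).indicator (hs i)]
  exact Finset.prod_congr rfl fun i _ => by
    rw [lintegral_indicator (hs i), withDensity_apply _ (hs i)]

end Product

section AbsoluteContinuity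

variable {Ω : Type*} [MeasurableSpace Ω]

lemma withDensity_apply_le_of_lintegral_sq_le (ν : Measure Ω) {f : Ω → ℝ≥0∞} {C t : ℝ≥0∞}
    (hC : ∫⁻ x, f x ^ 2 ∂ν ≤ C) (ht : t ≠ 0) (ht' : t ≠ ∞) {A : Set Ω} (hA : MeasurableSet A) :
    ν.withDensity f A ≤ t * ν A + t⁻¹ * C := by
  have h_le : ∀ x, f x ≤ t + t⁻¹ * f x ^ 2 := fun x => by
    rcases le_total (f x) t with h | h
    · exact h.trans le_self_add
    · calc f x = t⁻¹ * t * f x := by rw [ENNReal.inv_mul_cancel ht ht', one_mul]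
        _ ≤ t⁻¹ * f x * f x := by gcongr
        _ = t⁻¹ * f x ^ 2 := by ring
        _ ≤ _ := le_add_self
  calc ν.withDensity f A = ∫⁻ x in A, f x ∂ν := withDensity_apply _ hA
    _ ≤ ∫⁻ x in A, (t + t⁻¹ * f x ^ 2) ∂ν := lintegral_mono h_le
    _ = t * ν A + t⁻¹ * ∫⁻ x in A, f x ^ 2 ∂ν := by
      rw [lintegral_add_left measurable_const, setLIntegral_const,
        lintegral_const_mul' _ _ (ENNReal.inv_ne_top.2 ht)]
    _ ≤ t * ν A + t⁻¹ * C := by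
      gcongr
      exact (setLIntegral_le_lintegral _ _).trans hC

lemma absolutelyContinuous_of_forall_isSetAlgebra {μ ν : Measure Ω} [IsFiniteMeasure μ]
    [IsFiniteMeasure ν] {𝒜 : Set (Set Ω)} (h𝒜 : IsSetAlgebra 𝒜)
    (hgen : ‹MeasurableSpace Ω› = MeasurableSpace.generateFrom 𝒜) {C : ℝ≥0∞} (hC : C ≠ ∞)
    (h : ∀ A ∈ 𝒜, ∀ t : ℝ≥0∞, t ≠ 0 → t ≠ ∞ → μ A ≤ t * ν A + t⁻¹ * C) : μ ≪ ν := by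
  refine Measure.AbsolutelyContinuous.mk fun s hs hνs => ?_
  have h_bound : ∀ t : ℝ≥0∞, t ≠ 0 → t ≠ ∞ → μ s ≤ t⁻¹ * C := fun t ht ht' => by
    have key : ∀ ε : ℝ, 0 < ε → μ s ≤ t⁻¹ * C + (t + 1) * ENNReal.ofReal ε := fun ε hε => by
      obtain ⟨A, hA, hlt⟩ :=
        (Measure.MeasureDense.of_generateFrom_isSetAlgebra_finite (μ := μ + ν) h𝒜 hgen).approx s hs
          (measure_ne_top _ _) ε hε
      rw [Measure.add_apply] at hlt
      have hμ : μ (symmDiff s A) ≤ ENNReal.ofReal ε := le_self_add.trans hlt.le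
      have hν : ν (symmDiff s A) ≤ ENNReal.ofReal ε := le_add_self.trans hlt.le
      have hνA : ν A ≤ ENNReal.ofReal ε := by
        calc ν A ≤ ν (s ∪ symmDiff s A) := measure_mono fun x hx => by
              by_cases hxs : x ∈ s
              · exact Or.inl hxs
              · exact Or.inr (Or.inr ⟨hx, hxs⟩)
          _ ≤ ν s + ν (symmDiff s A) := measure_union_le _ _
          _ ≤ ENNReal.ofReal ε := by rwa [hνs, zero_add]
      calc μ s ≤ μ (A ∪ symmDiff s A) := measure_mono fun x hx => by
            by_cases hxA : x ∈ A
            · exact Or.inl hxA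
            · exact Or.inr (Or.inl ⟨hx, hxA⟩)
        _ ≤ μ A + μ (symmDiff s A) := measure_union_le _ _
        _ ≤ t * ENNReal.ofReal ε + t⁻¹ * C + ENNReal.ofReal ε := by
          gcongr
          exact (h A hA t ht ht').trans (by gcongr)
        _ = t⁻¹ * C + (t + 1) * ENNReal.ofReal ε := by ring
    have hlim : Filter.Tendsto (fun ε : ℝ => t⁻¹ * C + (t + 1) * ENNReal.ofReal ε)
        (nhdsWithin 0 (Set.Ioi 0)) (nhds (t⁻¹ * C + (t + 1) * 0)) := by
      refine tendsto_const_nhds.add (ENNReal.Tendsto.const_mul ?_ (Or.inr (by finiteness)))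
      simpa using (ENNReal.continuous_ofReal.tendsto (0 : ℝ)).mono_left nhdsWithin_le_nhds
    rw [mul_zero, add_zero] at hlim
    exact ge_of_tendsto hlim (by filter_upwards [self_mem_nhdsWithin] with ε hε using key ε hε)
  have hlim : Filter.Tendsto (fun n : ℕ => (n : ℝ≥0∞)⁻¹ * C) Filter.atTop (nhds (0 * C)) :=
    ENNReal.Tendsto.mul_const ENNReal.tendsto_inv_nat_nhds_zero (Or.inr hC)
  rw [zero_mul] at hlim
  refine le_antisymm (ge_of_tendsto hlim ?_) zero_le
  filter_upwards [Filter.eventually_ne_atTop 0] with n hn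
  exact h_bound n (by exact_mod_cast hn) (ENNReal.natCast_ne_top n)

/-- An infinite product of probability measures with square integrable densities is absolutely
continuous if the second moments of the densities have a convergent product. -/
theorem IsProjectiveLimit.absolutelyContinuous_of_lintegral_sq_le {ι : Type*} {X : ι → Type*}
    [∀ i, MeasurableSpace (X i)] {μ ν : ∀ i, Measure (X i)} [∀ i, IsProbabilityMeasure (μ i)]
    [∀ i, IsProbabilityMeasure (ν i)] {P Q : Measure (∀ i, X i)}
    (hP : IsProjectiveLimit P fun I : Finset ι => Measure.pi fun i : I => μ i.1)
    (hQ : IsProjectiveLimit Q fun I : Finset ι => Measure.pi fun i : I => ν i.1)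
    {f : ∀ i, X i → ℝ≥0∞} (hf : ∀ i, Measurable (f i))
    (hμ : ∀ i, μ i = (ν i).withDensity (f i)) {c : ι → ℝ} (hc : ∀ i, 0 ≤ c i) (hcs : Summable c)
    (hfc : ∀ i, ∫⁻ x, f i x ^ 2 ∂ν i ≤ ENNReal.ofReal (1 + c i)) : P ≪ Q := by
  have : IsProbabilityMeasure P := hP.isProbabilityMeasure
  have : IsProbabilityMeasure Q := hQ.isProbabilityMeasure
  refine absolutelyContinuous_of_forall_isSetAlgebra isSetAlgebra_measurableCylinders
    generateFrom_measurableCylinders.symm (C := ENNReal.ofReal (Real.exp (∑' i, c i)))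
    ENNReal.ofReal_ne_top fun A hA t ht ht' => ?_
  obtain ⟨I, S, hS, rfl⟩ := (mem_measurableCylinders _).mp hA
  rw [hP.measure_cylinder I hS, hQ.measure_cylinder I hS]
  have : ∀ i : I, IsProbabilityMeasure ((ν i.1).withDensity (f i.1)) := fun i =>
    hμ i.1 ▸ inferInstance
  have hpi : (Measure.pi fun i : I => μ i.1) =
      (Measure.pi fun i : I => ν i.1).withDensity fun x => ∏ i : I, f i.1 (x i) := by
    simp_rw [hμ]
    exact pi_withDensity_eq_withDensity_pi (fun i : I => ν i.1) fun i => hf i.1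
  rw [hpi]
  refine withDensity_apply_le_of_lintegral_sq_le _ ?_ ht ht' hS
  simp_rw [← Finset.prod_pow]
  rw [lintegral_pi_prod_eq_prod_lintegral (fun i : I => ν i.1) (f := fun i x => f i.1 x ^ 2)
    fun i => (hf i.1).pow_const 2]
  calc ∏ i : I, ∫⁻ x, f i.1 x ^ 2 ∂ν i.1 ≤ ∏ i : I, ENNReal.ofReal (1 + c i.1) :=
        Finset.prod_le_prod' fun i _ => hfc i.1
    _ = ENNReal.ofReal (∏ i : I, (1 + c i.1)) :=
        (ENNReal.ofReal_prod_of_nonneg fun i _ => by linarith [hc i.1]).symm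
    _ ≤ ENNReal.ofReal (Real.exp (∑' i, c i)) := by
        refine ENNReal.ofReal_le_ofReal ?_
        refine (Real.prod_one_add_le_exp_sum _ fun i : I => hc i.1).trans ?_
        rw [Real.exp_le_exp, Finset.sum_coe_sort I c]
        exact hcs.sum_le_tsum I fun i _ => hc i

end AbsoluteContinuity

section Cauchy

lemma isProbabilityMeasure_cauchyMeasure (δ : ℝ) {γ : ℝ} (hγ : 0 < γ) :
    IsProbabilityMeasure (cauchyMeasure δ γ) := by
  lift γ to NNReal using hγ.le
  have h : cauchyMeasure δ γ = ProbabilityTheory.cauchyMeasure δ γ := by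
    rw [ProbabilityTheory.cauchyMeasure_of_scale_ne_zero δ (NNReal.coe_pos.1 hγ).ne',
      cauchyMeasure]
    congr 1
    ext x
    rw [ProbabilityTheory.cauchyPDF_def, ProbabilityTheory.cauchyPDFReal_def, div_eq_mul_inv,
      mul_inv]
    ring_nf
  rw [h]
  infer_instance

/-- The density of the Cauchy measure of scale `a` with respect to the one of scale `b`. -/
noncomputable def cauchyRatio (δ a b x : ℝ) : ℝ :=
  a / b * (((x - δ) ^ 2 + b ^ 2) / ((x - δ) ^ 2 + a ^ 2))

lemma measurable_cauchyRatio (δ a b : ℝ) : Measurable (cauchyRatio δ a b) := by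
  unfold cauchyRatio
  fun_prop

variable {a b : ℝ}

lemma cauchyMeasure_eq_withDensity (δ : ℝ) (ha : 0 < a) (hb : 0 < b) :
    cauchyMeasure δ a =
      (cauchyMeasure δ b).withDensity fun x => ENNReal.ofReal (cauchyRatio δ a b x) := by
  rw [cauchyMeasure, cauchyMeasure, ← withDensity_mul _ (by fun_prop)
    (measurable_cauchyRatio δ a b).ennreal_ofReal]
  congr 1
  ext x
  rw [Pi.mul_apply, ← ENNReal.ofReal_mul (by positivity), cauchyRatio]
  congr 1
  have := pi_pos
  have : 0 < (x - δ) ^ 2 + a ^ 2 := by positivity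
  have : 0 < (x - δ) ^ 2 + b ^ 2 := by positivity
  field_simp

lemma cauchyRatio_nonneg (δ x : ℝ) (ha : 0 < a) (hb : 0 < b) : 0 ≤ cauchyRatio δ a b x := by
  unfold cauchyRatio
  positivity

lemma sq_cauchyRatio_sub_one_le (δ x : ℝ) (ha : 0 < a) (hb : 0 < b) :
    (cauchyRatio δ a b x - 1) ^ 2 ≤ (a / b - 1) ^ 2 + (b / a - 1) ^ 2 := by
  have hden : 0 < (x - δ) ^ 2 + a ^ 2 := by positivity
  set w := (x - δ) ^ 2 / ((x - δ) ^ 2 + a ^ 2) with hw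
  have hw0 : 0 ≤ w := by positivity
  have hw1 : w ≤ 1 := (div_le_one hden).2 (by nlinarith)
  have h : cauchyRatio δ a b x - 1 = w * (a / b - 1) + (1 - w) * (b / a - 1) := by
    rw [cauchyRatio, hw]
    field_simp
    ring
  rw [h]
  nlinarith [mul_nonneg (mul_nonneg hw0 (sub_nonneg.2 hw1)) (sq_nonneg (a / b - b / a)),
    mul_nonneg hw0 (sq_nonneg (b / a - 1)),
    mul_nonneg (sub_nonneg.2 hw1) (sq_nonneg (a / b - 1))]

lemma lintegral_sq_cauchyRatio_le (δ : ℝ) (ha : 0 < a) (hb : 0 < b) :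
    ∫⁻ x, ENNReal.ofReal (cauchyRatio δ a b x) ^ 2 ∂cauchyMeasure δ b ≤
      ENNReal.ofReal (1 + ((a / b - 1) ^ 2 + (b / a - 1) ^ 2)) := by
  have := isProbabilityMeasure_cauchyMeasure δ ha
  have := isProbabilityMeasure_cauchyMeasure δ hb
  set c := (a / b - 1) ^ 2 + (b / a - 1) ^ 2 with hc
  have hc0 : 0 ≤ c := by positivity
  have hmeas := (measurable_cauchyRatio δ a b).ennreal_ofReal
  have hone : ∫⁻ x, ENNReal.ofReal (cauchyRatio δ a b x) ∂cauchyMeasure δ b = 1 := by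
    rw [← setLIntegral_univ, ← withDensity_apply _ MeasurableSet.univ,
      ← cauchyMeasure_eq_withDensity δ ha hb, measure_univ]
  have hle : ∀ x, ENNReal.ofReal (cauchyRatio δ a b x) ^ 2 + 1 ≤
      2 * ENNReal.ofReal (cauchyRatio δ a b x) + ENNReal.ofReal c := fun x => by
    have h0 := cauchyRatio_nonneg δ x ha hb
    rw [← ENNReal.ofReal_pow h0, ← ENNReal.ofReal_one,
      ← ENNReal.ofReal_add (by positivity) one_pos.le,
      ← ENNReal.ofReal_ofNat 2, ← ENNReal.ofReal_mul (by norm_num),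
      ← ENNReal.ofReal_add (by positivity) hc0]
    exact ENNReal.ofReal_le_ofReal (by nlinarith [sq_cauchyRatio_sub_one_le δ x ha hb])
  have h := lintegral_mono (μ := cauchyMeasure δ b) hle
  rw [lintegral_add_right _ measurable_const, lintegral_add_right _ measurable_const,
    lintegral_const_mul _ hmeas, hone, lintegral_const, lintegral_const, measure_univ, mul_one,
    mul_one, mul_one] at h
  rw [ENNReal.ofReal_add one_pos.le hc0, ENNReal.ofReal_one]
  refine (ENNReal.add_le_add_iff_right ENNReal.one_ne_top).1 (h.trans_eq ?_)
  rw [← one_add_one_eq_two]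
  ring

lemma absolutelyContinuous_of_isProjectiveLimit_cauchyMeasure {ι : Type*} {δ a b : ι → ℝ}
    (ha : ∀ i, 0 < a i) (hb : ∀ i, 0 < b i) {P Q : Measure (ι → ℝ)}
    (hP : IsProjectiveLimit P fun I : Finset ι =>
      Measure.pi fun i : I => cauchyMeasure (δ i.1) (a i.1))
    (hQ : IsProjectiveLimit Q fun I : Finset ι =>
      Measure.pi fun i : I => cauchyMeasure (δ i.1) (b i.1))
    (hsum : Summable fun i => (a i / b i - 1) ^ 2 + (b i / a i - 1) ^ 2) : P ≪ Q := by
  have := fun i => isProbabilityMeasure_cauchyMeasure (δ i) (ha i)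
  have := fun i => isProbabilityMeasure_cauchyMeasure (δ i) (hb i)
  exact IsProjectiveLimit.absolutelyContinuous_of_lintegral_sq_le hP hQ
    (fun i => (measurable_cauchyRatio (δ i) (a i) (b i)).ennreal_ofReal)
    (fun i => cauchyMeasure_eq_withDensity (δ i) (ha i) (hb i)) (fun i => by positivity) hsum
    fun i => lintegral_sq_cauchyRatio_le (δ i) (ha i) (hb i)

end Cauchy

lemma summable_sq_inv_sub_one {σ : ℕ → ℝ} (hsum : Summable fun n => (σ n - 1) ^ 2) :
    Summable fun n => ((σ n)⁻¹ - 1) ^ 2 := by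
  refine Summable.of_norm_bounded_eventually_nat (hsum.mul_left 4) ?_
  filter_upwards [hsum.tendsto_atTop_zero.eventually_lt_const (show (0 : ℝ) < 1 / 4 by norm_num)]
    with n hn
  have hσ : 1 / 2 < σ n := by nlinarith
  have hσ0 : 0 < σ n := by linarith
  rw [Real.norm_of_nonneg (sq_nonneg _), show (σ n)⁻¹ - 1 = (1 - σ n) / σ n by field_simp, div_pow,
    div_le_iff₀ (by positivity)]
  nlinarith [mul_nonneg (sq_nonneg (σ n - 1)) (show 0 ≤ 4 * σ n ^ 2 - 1 by nlinarith)]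

theorem cauchy_product_dilations_summable_implies_equivalent
    (δ γ σ : ℕ → ℝ) (hγ : ∀ n, 0 < γ n) (hσ : ∀ n, 0 < σ n)
    (P Q : Measure (ℕ → ℝ))
    (hP : IsProjectiveLimit P fun I : Finset ℕ =>
      Measure.pi fun i : I => cauchyMeasure (δ i.1) (γ i.1))
    (hQ : IsProjectiveLimit Q fun I : Finset ℕ =>
      Measure.pi fun i : I => cauchyMeasure (δ i.1) (σ i.1 * γ i.1))
    (hsum : Summable fun n => (σ n - 1) ^ 2) :
    P ≪ Q ∧ Q ≪ P := by
  have hσγ : ∀ n, 0 < σ n * γ n := fun n => mul_pos (hσ n) (hγ n)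
  have h_div : ∀ n, σ n * γ n / γ n = σ n := fun n => mul_div_cancel_right₀ _ (hγ n).ne'
  have h_inv : ∀ n, γ n / (σ n * γ n) = (σ n)⁻¹ := fun n => by rw [← inv_div, h_div]
  have hsum_inv := summable_sq_inv_sub_one hsum
  constructor
  · refine absolutelyContinuous_of_isProjectiveLimit_cauchyMeasure hγ hσγ hP hQ ?_
    simpa only [h_div, h_inv] using hsum_inv.add hsum
  · refine absolutelyContinuous_of_isProjectiveLimit_cauchyMeasure hσγ hγ hQ hP ?_
    simpa only [h_div, h_inv] using hsum.add hsum_inv
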